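/- arXiv:2001.06947 — 2 statements merged into one kernel-verified Lean document; each statement's English description precedes it below -/
import Mathlib

section
/- Let k > 0, τ > 0, r > 0 and ω ∈ S¹, and set ξ = r(τω + i√(τ²+k²) ω⊥) ∈ ℂ². Then for every integer m: if m ≥ 0, (1/2π) ∫_{S¹} e^{ϑ·ξ} (ϑ₁ + iϑ₂)^m dσ(ϑ) = ((τ+√(τ²+k²))ω/k)^m J_m(kr); if m < 0, (1/2π) ∫_{S¹} e^{ϑ·ξ} (ϑ₁ + iϑ₂)^m dσ(ϑ) = ((τ−√(τ²+k²)) ω̄ /k)^{−m} J_{−m}(kr). -/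
open MeasureTheory Real

/-- The Bessel function of integer order `m ≥ 0`, defined by its power series. -/
noncomputable def besselJ (m : ℕ) (z : ℂ) : ℂ :=
  (z / 2) ^ m * ∑' n : ℕ, ((-1 : ℂ) ^ n / ((n.factorial : ℂ) * ((n + m).factorial : ℂ))) * (z / 2) ^ (2 * n)

/-- The integral of the character `θ ↦ exp (iθ) ^ n` over a period. -/
theorem integral_exp_mul_I_zpow (n : ℤ) :
    ∫ θ in (0 : ℝ)..(2 * π), Complex.exp (θ * Complex.I) ^ n =
      if n = 0 then 2 * (π : ℂ) else 0 := by
  split_ifs with hn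
  · simp [hn]
  · have hc : (n : ℂ) * Complex.I ≠ 0 := by simp [hn]
    have h : ∀ θ : ℝ, Complex.exp (θ * Complex.I) ^ n =
        Complex.exp ((n : ℂ) * Complex.I * θ) := fun θ => by
      rw [← Complex.exp_int_mul]
      congr 1
      ring
    simp_rw [h]
    rw [integral_exp_mul_complex hc]
    have h2 : (n : ℂ) * Complex.I * ((2 * π : ℝ) : ℂ) = n * (2 * π * Complex.I) := by
      push_cast
      ring
    rw [h2, Complex.exp_int_mul_two_pi_mul_I]
    simp

/-- The Laurent expansion of `exp (a z + b / z) z ^ m`, for `z ≠ 0`. -/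
theorem hasSum_exp_add_inv_mul_zpow (a b : ℂ) (m : ℤ) {z : ℂ} (hz : z ≠ 0) :
    HasSum (fun p : ℕ × ℕ => a ^ p.1 / p.1.factorial * (b ^ p.2 / p.2.factorial) *
      z ^ ((p.1 : ℤ) - p.2 + m)) (Complex.exp (a * z + b * z⁻¹) * z ^ m) := by
  have hs : Summable fun p : ℕ × ℕ =>
      (a * z) ^ p.1 / (p.1.factorial : ℂ) * ((b * z⁻¹) ^ p.2 / (p.2.factorial : ℂ)) :=
    summable_mul_of_summable_norm (f := fun n : ℕ => (a * z) ^ n / (n.factorial : ℂ))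
      (g := fun n : ℕ => (b * z⁻¹) ^ n / (n.factorial : ℂ))
      (NormedSpace.norm_expSeries_div_summable (a * z))
      (NormedSpace.norm_expSeries_div_summable (b * z⁻¹))
  have h : HasSum (fun p : ℕ × ℕ =>
      (a * z) ^ p.1 / (p.1.factorial : ℂ) * ((b * z⁻¹) ^ p.2 / (p.2.factorial : ℂ)))
      (Complex.exp (a * z) * Complex.exp (b * z⁻¹)) := by
    rw [Complex.exp_eq_exp_ℂ]
    exact HasSum.mul (f := fun n : ℕ => (a * z) ^ n / (n.factorial : ℂ))
      (g := fun n : ℕ => (b * z⁻¹) ^ n / (n.factorial : ℂ)) (NormedSpace.expSeries_div_hasSum_exp (a * z))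
      (NormedSpace.expSeries_div_hasSum_exp (b * z⁻¹)) hs
  rw [Complex.exp_add]
  convert! h.mul_right (z ^ m) using 2 with p
  rw [zpow_add₀ hz, zpow_sub₀ hz, zpow_natCast, zpow_natCast, mul_pow, mul_pow, inv_pow]
  ring

/-- Termwise integration of the Laurent expansion of `exp (a z + b / z) z ^ m` over the circle. -/
theorem hasSum_integral_exp_add_inv_mul_zpow (a b : ℂ) (m : ℤ) :
    HasSum (fun p : ℕ × ℕ => if (p.1 : ℤ) - p.2 + m = 0 then
        a ^ p.1 / p.1.factorial * (b ^ p.2 / p.2.factorial) else 0)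
      (1 / (2 * (π : ℂ)) * ∫ θ in (0 : ℝ)..(2 * π),
        Complex.exp (a * Complex.exp (θ * Complex.I) + b * (Complex.exp (θ * Complex.I))⁻¹) *
          Complex.exp (θ * Complex.I) ^ m) := by
  have hpi : (2 * (π : ℂ)) ≠ 0 := by simp [Real.pi_ne_zero]
  obtain ⟨c, hc⟩ : ∃ c : ℕ × ℕ → ℂ,
      ∀ p, a ^ p.1 / p.1.factorial * (b ^ p.2 / p.2.factorial) = c p := ⟨_, fun _ => rfl⟩
  have hsum : Summable fun p => ‖c p‖ := by
    simpa only [hc] using (NormedSpace.norm_expSeries_div_summable a).mul_norm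
      (NormedSpace.norm_expSeries_div_summable b)
  have hexp : ∀ θ : ℝ, HasSum
      (fun p : ℕ × ℕ => c p * Complex.exp (θ * Complex.I) ^ ((p.1 : ℤ) - p.2 + m))
      (Complex.exp (a * Complex.exp (θ * Complex.I) + b * (Complex.exp (θ * Complex.I))⁻¹) *
        Complex.exp (θ * Complex.I) ^ m) := fun θ => by
    simpa only [hc] using hasSum_exp_add_inv_mul_zpow a b m (Complex.exp_ne_zero (θ * Complex.I))
  have hmeas : ∀ p : ℕ × ℕ, Continuous fun θ : ℝ =>
      c p * Complex.exp (θ * Complex.I) ^ ((p.1 : ℤ) - p.2 + m) := fun p =>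
    continuous_const.mul (Continuous.zpow₀ (by fun_prop) _ fun θ =>
      Or.inl (Complex.exp_ne_zero _))
  have hnorm : ∀ (p : ℕ × ℕ) (θ : ℝ),
      ‖c p * Complex.exp (θ * Complex.I) ^ ((p.1 : ℤ) - p.2 + m)‖ ≤ ‖c p‖ := fun p θ => by
    rw [norm_mul, norm_zpow, Complex.norm_exp_ofReal_mul_I, one_zpow, mul_one]
  have h := intervalIntegral.hasSum_integral_of_dominated_convergence (μ := volume)
    (a := 0) (b := 2 * π) (fun p _ => ‖c p‖) (fun p => (hmeas p).aestronglyMeasurable)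
    (fun p => ae_of_all _ fun θ _ => hnorm p θ) (ae_of_all _ fun _ _ => hsum)
    intervalIntegrable_const (ae_of_all _ fun θ _ => hexp θ)
  convert! h.mul_left (1 / (2 * (π : ℂ))) using 2 with p
  rw [intervalIntegral.integral_const_mul, integral_exp_mul_I_zpow, hc]
  split_ifs
  · field_simp
  · simp

/-- The generating-function integral for Bessel functions, with nonnegative exponent. -/
theorem integral_exp_add_inv_mul_pow (a b z : ℂ) (h : a * b = -(z / 2) ^ 2) (c : ℂ)
    (hb : b = c * (z / 2)) (m : ℕ) :
    1 / (2 * (π : ℂ)) * ∫ θ in (0 : ℝ)..(2 * π),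
        Complex.exp (a * Complex.exp (θ * Complex.I) + b * (Complex.exp (θ * Complex.I))⁻¹) *
          Complex.exp (θ * Complex.I) ^ (m : ℤ) = c ^ m * besselJ m z := by
  have hs := hasSum_integral_exp_add_inv_mul_zpow a b m
  have hinj : Function.Injective fun n : ℕ => (n, n + m) := fun x y hxy => (Prod.ext_iff.1 hxy).1
  rw [← hinj.hasSum_iff] at hs
  · rw [← hs.tsum_eq, besselJ, ← mul_assoc, ← mul_pow, ← hb, ← tsum_mul_left]
    refine tsum_congr fun n => ?_
    have : (-1 : ℂ) ^ n * (z / 2) ^ (2 * n) = a ^ n * b ^ n := by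
      rw [pow_mul, ← mul_pow, ← mul_pow, h, neg_one_mul]
    simp only [Function.comp_apply, Nat.cast_add, sub_add_cancel_left, neg_add_cancel, if_true]
    rw [div_mul_eq_mul_div, div_mul_eq_mul_div, this, pow_add]
    ring
  · rintro ⟨i, j⟩ hij
    refine if_neg fun h0 => hij ⟨i, ?_⟩
    simp only [Prod.mk.injEq, true_and]
    simp only at h0
    omega

/-- The generating-function integral for Bessel functions, with nonpositive exponent. -/
theorem integral_exp_add_inv_mul_neg_pow (a b z : ℂ) (h : a * b = -(z / 2) ^ 2) (c : ℂ)
    (ha : a = c * (z / 2)) (m : ℕ) :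
    1 / (2 * (π : ℂ)) * ∫ θ in (0 : ℝ)..(2 * π),
        Complex.exp (a * Complex.exp (θ * Complex.I) + b * (Complex.exp (θ * Complex.I))⁻¹) *
          Complex.exp (θ * Complex.I) ^ (-(m : ℤ)) = c ^ m * besselJ m z := by
  have hs := hasSum_integral_exp_add_inv_mul_zpow a b (-(m : ℤ))
  have hinj : Function.Injective fun n : ℕ => (n + m, n) := fun x y hxy => (Prod.ext_iff.1 hxy).2
  rw [← hinj.hasSum_iff] at hs
  · rw [← hs.tsum_eq, besselJ, ← mul_assoc, ← mul_pow, ← ha, ← tsum_mul_left]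
    refine tsum_congr fun n => ?_
    have : (-1 : ℂ) ^ n * (z / 2) ^ (2 * n) = a ^ n * b ^ n := by
      rw [pow_mul, ← mul_pow, ← mul_pow, h, neg_one_mul]
    simp only [Function.comp_apply, Nat.cast_add, add_sub_cancel_left, add_neg_cancel, if_true]
    rw [div_mul_eq_mul_div, div_mul_eq_mul_div, this, pow_add]
    ring
  · rintro ⟨i, j⟩ hij
    refine if_neg fun h0 => hij ⟨j, ?_⟩
    simp only [Prod.mk.injEq, and_true]
    simp only at h0
    omega

/-- On the unit circle a linear form is a combination of `z` and `z⁻¹`. -/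
theorem cos_mul_add_sin_mul_eq (p q : ℂ) (θ : ℝ) :
    (Real.cos θ : ℂ) * p + (Real.sin θ : ℂ) * q =
      (p - Complex.I * q) / 2 * Complex.exp (θ * Complex.I) +
        (p + Complex.I * q) / 2 * (Complex.exp (θ * Complex.I))⁻¹ := by
  rw [← Complex.exp_neg, ← neg_mul, Complex.exp_mul_I, Complex.exp_mul_I, Complex.cos_neg,
    Complex.sin_neg, Complex.ofReal_cos, Complex.ofReal_sin]
  linear_combination (Complex.sin θ * q) * Complex.I_sq

/-- the circle moment integrals for `ξ = r(τω + i√(τ²+k²) ω⊥)`. -/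
theorem circle_moment_integral_bessel (k τ r : ℝ) (hk : 0 < k) (hτ : 0 < τ) (hr : 0 < r)
    (ω₁ ω₂ : ℝ) (hω : ω₁ ^ 2 + ω₂ ^ 2 = 1) (m : ℤ) :
    (0 ≤ m →
      (1 / (2 * (π : ℂ))) *
          ∫ θ in (0:ℝ)..(2 * π),
            Complex.exp
              ((Real.cos θ : ℂ) * ((r : ℂ) * ((τ : ℂ) * (ω₁ : ℂ) +
                  Complex.I * (Real.sqrt (τ ^ 2 + k ^ 2) : ℂ) * (ω₂ : ℂ))) +
               (Real.sin θ : ℂ) * ((r : ℂ) * ((τ : ℂ) * (ω₂ : ℂ) -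
                  Complex.I * (Real.sqrt (τ ^ 2 + k ^ 2) : ℂ) * (ω₁ : ℂ)))) *
              (Complex.exp (θ * Complex.I)) ^ m
        = ((((τ + Real.sqrt (τ ^ 2 + k ^ 2)) / k : ℝ) : ℂ) * ((ω₁ : ℂ) + Complex.I * (ω₂ : ℂ))) ^ m.toNat *
            besselJ m.toNat (k * r)) ∧
    (m < 0 →
      (1 / (2 * (π : ℂ))) *
          ∫ θ in (0:ℝ)..(2 * π),
            Complex.exp
              ((Real.cos θ : ℂ) * ((r : ℂ) * ((τ : ℂ) * (ω₁ : ℂ) +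
                  Complex.I * (Real.sqrt (τ ^ 2 + k ^ 2) : ℂ) * (ω₂ : ℂ))) +
               (Real.sin θ : ℂ) * ((r : ℂ) * ((τ : ℂ) * (ω₂ : ℂ) -
                  Complex.I * (Real.sqrt (τ ^ 2 + k ^ 2) : ℂ) * (ω₁ : ℂ)))) *
              (Complex.exp (θ * Complex.I)) ^ m
        = ((((τ - Real.sqrt (τ ^ 2 + k ^ 2)) / k : ℝ) : ℂ) * ((ω₁ : ℂ) - Complex.I * (ω₂ : ℂ))) ^ (-m).toNat *
            besselJ (-m).toNat (k * r)) := by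
  have hsq : (√(τ ^ 2 + k ^ 2) : ℂ) ^ 2 = (τ : ℂ) ^ 2 + (k : ℂ) ^ 2 := by
    exact_mod_cast Real.sq_sqrt (by positivity : 0 ≤ τ ^ 2 + k ^ 2)
  have hω' : (ω₁ : ℂ) ^ 2 + (ω₂ : ℂ) ^ 2 = 1 := by exact_mod_cast hω
  have hk' : (k : ℂ) ≠ 0 := by exact_mod_cast hk.ne'
  simp_rw [cos_mul_add_sin_mul_eq]
  push_cast
  generalize (√(τ ^ 2 + k ^ 2) : ℂ) = s at *
  have ha : ((r : ℂ) * (τ * ω₁ + Complex.I * s * ω₂) -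
      Complex.I * (r * (τ * ω₂ - Complex.I * s * ω₁))) / 2 =
      (τ - s) / k * (ω₁ - Complex.I * ω₂) * (k * r / 2) := by
    field_simp
    linear_combination (r * s * ω₁) * Complex.I_sq
  have hb : ((r : ℂ) * (τ * ω₁ + Complex.I * s * ω₂) +
      Complex.I * (r * (τ * ω₂ - Complex.I * s * ω₁))) / 2 =
      (τ + s) / k * (ω₁ + Complex.I * ω₂) * (k * r / 2) := by
    field_simp
    linear_combination (-r * s * ω₁) * Complex.I_sq
  rw [ha, hb]
  have hab : (τ - s) / k * (ω₁ - Complex.I * ω₂) * (k * r / 2) *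
      ((τ + s) / k * (ω₁ + Complex.I * ω₂) * (k * r / 2)) = -((k * r : ℂ) / 2) ^ 2 := by
    have h1 : (ω₁ - Complex.I * ω₂) * (ω₁ + Complex.I * ω₂) = 1 := by
      linear_combination hω' - (ω₂ : ℂ) ^ 2 * Complex.I_sq
    have h2 : ((τ : ℂ) - s) * (τ + s) = -k ^ 2 := by linear_combination -hsq
    calc _ = ((τ - s) * (τ + s)) * ((ω₁ - Complex.I * ω₂) * (ω₁ + Complex.I * ω₂)) *
          (r / 2) ^ 2 := by field_simp
      _ = _ := by rw [h1, h2]; ring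
  constructor
  · intro hm
    lift m to ℕ using hm
    exact integral_exp_add_inv_mul_pow _ _ _ hab _ rfl m
  · intro hm
    obtain ⟨n, rfl⟩ : ∃ n : ℕ, m = -n := ⟨(-m).toNat, by omega⟩
    rw [neg_neg, Int.toNat_natCast]
    exact integral_exp_add_inv_mul_neg_pow _ _ _ hab _ rfl n
end

section
/- Let k > 0 and φ ∈ S¹. The Vekua transform T_k of the harmonic function y ↦ exp(ik φ̄ (y₁ + iy₂)/2) + exp(ik φ (y₁ − iy₂)/2) − 1 coincides with the function y ↦ e^{ik y·φ}; that is, for every y ∈ ℝ², T_k(exp(ik φ̄ (·₁ + i·₂)/2) + exp(ik φ (·₁ − i·₂)/2) − 1)(y) = e^{ik y·φ}. -/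
open MeasureTheory Real

/-- The two-dimensional Vekua transform
`T_k v(x) = v(x) - (k|x|/2) ∫₀¹ v(tx) J₁(k|x|√(1-t)) dt/√(1-t)`. -/
noncomputable def vekua (k : ℝ) (v : ℝ × ℝ → ℂ) (x : ℝ × ℝ) : ℂ :=
  v x - ((k * Real.sqrt (x.1 ^ 2 + x.2 ^ 2) / 2 : ℝ) : ℂ) *
    ∫ t in (0:ℝ)..1,
      v (t * x.1, t * x.2) * besselJ 1 ((k * Real.sqrt (x.1 ^ 2 + x.2 ^ 2) * Real.sqrt (1 - t) : ℝ)) /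
        ((Real.sqrt (1 - t) : ℝ) : ℂ)

open Nat in
/-- The Euler beta integral at positive integers. -/
lemma integral_pow_mul_one_sub_pow (m n : ℕ) :
    ∫ t in (0:ℝ)..1, (t : ℂ) ^ m * (1 - (t : ℂ)) ^ n = (m ! : ℂ) * n ! / (m + n + 1)! := by
  have h := Complex.Gamma_mul_Gamma_eq_betaIntegral (s := m + 1) (t := n + 1)
    (by simp; positivity) (by simp; positivity)
  have e : (m + 1 + (n + 1) : ℂ) = ((m + n + 1 : ℕ) : ℂ) + 1 := by push_cast; ring
  rw [e, Complex.Gamma_nat_eq_factorial, Complex.Gamma_nat_eq_factorial,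
    Complex.Gamma_nat_eq_factorial] at h
  rw [h, mul_div_cancel_left₀ _ (by exact_mod_cast factorial_ne_zero _), Complex.betaIntegral]
  simp

open Nat in
/-- The entire function `z ↦ ∑ zⁿ / (n! (n+1)!)`, through which `J₁(w) = (w/2) K(-w²/4)`. -/
noncomputable def besselKernel (z : ℂ) : ℂ := ∑' n : ℕ, z ^ n / ((n ! : ℂ) * (n + 1)!)

open Nat in
lemma summable_norm_besselKernel (z : ℂ) :
    Summable fun n : ℕ => ‖z ^ n / ((n ! : ℂ) * (n + 1)!)‖ := by
  refine (NormedSpace.norm_expSeries_div_summable z).of_nonneg_of_le (fun _ => norm_nonneg _)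
    fun n => ?_
  rw [norm_div, norm_div, norm_mul, Complex.norm_natCast, Complex.norm_natCast]
  have h1 : (1 : ℝ) ≤ (n + 1)! := by exact_mod_cast (n + 1).factorial_pos
  have h2 : (0 : ℝ) < n ! := by exact_mod_cast n.factorial_pos
  gcongr
  exact le_mul_of_one_le_right h2.le h1

lemma besselJ_one_eq (z : ℂ) : besselJ 1 z = z / 2 * besselKernel (-(z / 2) ^ 2) := by
  rw [besselJ, besselKernel, pow_one]
  congr 1
  refine tsum_congr fun n => ?_
  rw [neg_pow ((z / 2) ^ 2), ← pow_mul]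
  ring

lemma HasSum.mul_of_norm {ι κ : Type*} (f : ι → ℂ) (g : κ → ℂ) {s u : ℂ} (hf : HasSum f s)
    (hg : HasSum g u) : HasSum (fun p : ι × κ => f p.1 * g p.2) (s * u) :=
  hf.mul hg (summable_mul_of_summable_norm hf.summable.norm hg.summable.norm)

open Nat in
lemma hasSum_integral_mul_besselKernel {w : ℕ → ℂ} {v : ℝ → ℂ} (c : ℂ)
    (hw : Summable fun m => ‖w m / (m !)‖)
    (hv : ∀ t : ℝ, HasSum (fun m => w m * (t : ℂ) ^ m / m !) (v t)) :
    HasSum (fun p : ℕ × ℕ => w p.1 * c ^ (p.2 + 1) / (((p.1 + p.2 + 1)! : ℂ) * (p.2 + 1)!))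
      (c * ∫ t in (0:ℝ)..1, v t * besselKernel (c * (1 - t))) := by
  have hsum : Summable fun p : ℕ × ℕ =>
      ‖w p.1 / (p.1 !)‖ * ‖c ^ p.2 / ((p.2 ! : ℂ) * (p.2 + 1)!)‖ :=
    hw.mul_of_nonneg (summable_norm_besselKernel c) (fun _ => norm_nonneg _) fun _ => norm_nonneg _
  have key : HasSum (fun p : ℕ × ℕ => ∫ t in (0:ℝ)..1, w p.1 * (t : ℂ) ^ p.1 / p.1 ! *
        ((c * (1 - t)) ^ p.2 / ((p.2 ! : ℂ) * (p.2 + 1)!)))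
      (∫ t in (0:ℝ)..1, v t * besselKernel (c * (1 - t))) := by
    refine intervalIntegral.hasSum_integral_of_dominated_convergence
      (fun p _ => ‖w p.1 / (p.1 !)‖ * ‖c ^ p.2 / ((p.2 ! : ℂ) * (p.2 + 1)!)‖)
      (fun p => (by fun_prop : Continuous _).aestronglyMeasurable) (fun p => ?_)
      (.of_forall fun t _ => ?_) ?_ (.of_forall fun t ht => ?_)
    · refine .of_forall fun t ht => ?_
      rw [Set.uIoc_of_le zero_le_one, Set.mem_Ioc] at ht
      have h1 : ‖(t : ℂ)‖ ≤ 1 := by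
        rw [Complex.norm_real, Real.norm_eq_abs, abs_le]; constructor <;> linarith
      have h2 : ‖1 - (t : ℂ)‖ ≤ 1 := by
        rw [← Complex.ofReal_one, ← Complex.ofReal_sub, Complex.norm_real, Real.norm_eq_abs,
          abs_le]
        constructor <;> linarith
      rw [norm_mul]
      gcongr ?_ * ?_
      · rw [norm_div, norm_div, norm_mul, norm_pow]
        gcongr
        exact mul_le_of_le_one_right (norm_nonneg _) (pow_le_one₀ (norm_nonneg _) h1)
      · rw [norm_div, norm_div, mul_pow, norm_mul, norm_pow (1 - (t : ℂ))]
        gcongr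
        exact mul_le_of_le_one_right (norm_nonneg _) (pow_le_one₀ (norm_nonneg _) h2)
    · exact hsum
    · exact intervalIntegrable_const
    · exact HasSum.mul_of_norm (fun m => w m * (t : ℂ) ^ m / m !)
        (fun n => (c * (1 - t)) ^ n / ((n ! : ℂ) * (n + 1)!)) (hv t)
        (summable_norm_besselKernel (c * (1 - t))).of_norm.hasSum
  convert! key.mul_left c using 2 with p
  obtain ⟨m, n⟩ := p
  have e : ∀ t : ℝ, w m * (t : ℂ) ^ m / m ! * ((c * (1 - t)) ^ n / ((n ! : ℂ) * (n + 1)!)) =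
      w m * c ^ n / ((m ! : ℂ) * (n ! * (n + 1)!)) * ((t : ℂ) ^ m * (1 - (t : ℂ)) ^ n) := by
    intro t; rw [mul_pow]; field_simp
  simp only [e, intervalIntegral.integral_const_mul, integral_pow_mul_one_sub_pow]
  have h (k : ℕ) : (k ! : ℂ) ≠ 0 := by exact_mod_cast factorial_ne_zero k
  have := h m; have := h n; have := h (n + 1); have := h (m + n + 1)
  field_simp
  ring

lemma hasSum_ite_of_injective {γ β : Type*} {f : β → ℂ} {e : γ → β} (he : e.Injective)
    {P : β → Prop} [DecidablePred P] (hP : ∀ b, P b ↔ b ∈ Set.range e) {s : ℂ}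
    (h : HasSum (fun x => f (e x)) s) : HasSum (fun b => if P b then f b else 0) s := by
  refine (he.hasSum_iff fun b hb => if_neg fun h' => hb ((hP b).1 h')).1 ?_
  convert h using 2 with x
  exact if_pos ((hP _).2 ⟨x, rfl⟩)

open Nat in
lemma hasSum_cexp (z : ℂ) : HasSum (fun n : ℕ => z ^ n / n !) (Complex.exp z) := by
  rw [Complex.exp_eq_exp_ℂ]
  exact NormedSpace.expSeries_div_hasSum_exp z

/-- A double series split into its two axes, the parts on either side of the diagonal, and the
diagonal. -/
lemma HasSum.triangle_decomposition {f : ℕ × ℕ → ℂ} {s x y : ℂ} (hf : HasSum f s)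
    (hx : HasSum (fun m => f (m, 0)) x) (hy : HasSum (fun m => f (0, m)) y) :
    HasSum (fun p : ℕ × ℕ => f (p.1 + p.2 + 1, p.2 + 1) + f (p.2 + 1, p.1 + p.2 + 1) -
      if p.1 = 0 then f (p.2 + 1, p.2 + 1) else 0) (s - (x + y - f (0, 0))) := by
  have hiA : Function.Injective fun p : ℕ × ℕ => (p.1 + p.2 + 1, p.2 + 1) := by
    rintro ⟨m, n⟩ ⟨m', n'⟩ h; simp only [Prod.mk.injEq] at h ⊢; omega
  have hiB : Function.Injective fun p : ℕ × ℕ => (p.2 + 1, p.1 + p.2 + 1) := by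
    rintro ⟨m, n⟩ ⟨m', n'⟩ h; simp only [Prod.mk.injEq] at h ⊢; omega
  have hiD : Function.Injective fun n : ℕ => (n + 1, n + 1) := by
    intro n n' h; simp only [Prod.mk.injEq] at h; omega
  obtain ⟨A, hA⟩ := hf.summable.comp_injective hiA
  obtain ⟨B, hB⟩ := hf.summable.comp_injective hiB
  obtain ⟨D, hD⟩ := hf.summable.comp_injective hiD
  have hA' := hasSum_ite_of_injective (P := fun p : ℕ × ℕ => 1 ≤ p.2 ∧ p.2 ≤ p.1) hiA (by
    rintro ⟨i, j⟩
    simp only [Set.mem_range, Prod.mk.injEq, Prod.exists]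
    exact ⟨fun h => ⟨i - j, j - 1, by omega, by omega⟩, fun ⟨m, n, h⟩ => by omega⟩) hA
  have hB' := hasSum_ite_of_injective (P := fun p : ℕ × ℕ => 1 ≤ p.1 ∧ p.1 ≤ p.2) hiB (by
    rintro ⟨i, j⟩
    simp only [Set.mem_range, Prod.mk.injEq, Prod.exists]
    exact ⟨fun h => ⟨j - i, i - 1, by omega, by omega⟩, fun ⟨m, n, h⟩ => by omega⟩) hB
  have hD' := hasSum_ite_of_injective (P := fun p : ℕ × ℕ => 1 ≤ p.1 ∧ p.1 = p.2) hiD (by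
    rintro ⟨i, j⟩
    simp only [Set.mem_range, Prod.mk.injEq]
    exact ⟨fun h => ⟨i - 1, by omega, by omega⟩, fun ⟨n, h⟩ => by omega⟩) hD
  have hx' := hasSum_ite_of_injective (f := f) (P := fun p : ℕ × ℕ => p.2 = 0)
    (e := fun m => (m, 0)) (fun _ _ h => by simpa using h) (by
      rintro ⟨i, j⟩; simp [eq_comm]) hx
  have hy' := hasSum_ite_of_injective (f := f) (P := fun p : ℕ × ℕ => p.1 = 0)
    (e := fun m => (0, m)) (fun _ _ h => by simpa using h) (by
      rintro ⟨i, j⟩; simp [eq_comm]) hy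
  have hO' := hasSum_ite_of_injective (f := f) (P := fun p : ℕ × ℕ => p.1 = 0 ∧ p.2 = 0)
    (e := fun _ : Unit => (0, 0)) (fun _ _ _ => rfl) (by
      rintro ⟨i, j⟩; simp) (hasSum_unique fun _ : Unit => f (0, 0))
  have hdiag : HasSum (fun p : ℕ × ℕ => if p.1 = 0 then f (p.2 + 1, p.2 + 1) else 0) D :=
    hasSum_ite_of_injective (f := fun p : ℕ × ℕ => f (p.2 + 1, p.2 + 1))
      (P := fun p : ℕ × ℕ => p.1 = 0) (e := fun n => (0, n)) (fun _ _ h => by simpa using h)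
      (by rintro ⟨i, j⟩; simp [eq_comm]) hD
  have htot : x + y - f (0, 0) + (A + B - D) = s :=
    (((hx'.add hy').sub hO').add ((hA'.add hB').sub hD')).unique (by
      convert! hf using 2 with p
      obtain ⟨i, j⟩ := p
      dsimp only
      split_ifs <;> first | omega | ring)
  rw [← htot, add_sub_cancel_left]
  exact (hA.add hB).sub hdiag

open Nat in
lemma exp_add_exp_sub_one_add_integral (a b : ℂ) :
    Complex.exp a + Complex.exp b - 1 + a * b * ∫ t in (0:ℝ)..1,
      (Complex.exp (a * t) + Complex.exp (b * t) - 1) * besselKernel (a * b * (1 - t)) =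
    Complex.exp (a + b) := by
  have ha := NormedSpace.norm_expSeries_div_summable a
  have hb := NormedSpace.norm_expSeries_div_summable b
  have hf : HasSum (fun p : ℕ × ℕ => a ^ p.1 / p.1 ! * (b ^ p.2 / p.2 !))
      (Complex.exp (a + b)) := by
    rw [Complex.exp_add]
    exact HasSum.mul_of_norm (fun m => a ^ m / m !) (fun n => b ^ n / n !) (hasSum_cexp a)
      (hasSum_cexp b)
  have hdec := hf.triangle_decomposition (x := Complex.exp a) (y := Complex.exp b)
    (by simpa using hasSum_cexp a) (by simpa using hasSum_cexp b)
  have hw : Summable fun m => ‖(a ^ m + b ^ m - 0 ^ m) / (m ! : ℂ)‖ := by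
    simp only [add_div, sub_div]
    exact ((ha.of_norm.add hb.of_norm).sub
      (NormedSpace.norm_expSeries_div_summable (0 : ℂ)).of_norm).norm
  have hv (t : ℝ) : HasSum (fun m => (a ^ m + b ^ m - 0 ^ m) * (t : ℂ) ^ m / m !)
      (Complex.exp (a * t) + Complex.exp (b * t) - 1) := by
    have h := ((hasSum_cexp (a * t)).add (hasSum_cexp (b * t))).sub (hasSum_cexp (0 * t))
    rw [zero_mul, Complex.exp_zero] at h
    convert! h using 2 with m
    have h0 : (0 : ℂ) ^ m * (t : ℂ) ^ m = 0 ^ m := by rw [← mul_pow, zero_mul]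
    rw [mul_pow, mul_pow]
    linear_combination (-1 / (m ! : ℂ)) * h0
  have hint := hasSum_integral_mul_besselKernel (a * b) hw hv
  have heq := hint.unique (by
    convert hdec using 2 with p
    obtain ⟨m, n⟩ := p
    rcases m with _ | m
    · simp
      ring
    · simp
      ring)
  rw [heq]
  simp

/-- the Vekua transform of the harmonic function
`y ↦ exp(ik φ̄ (y₁+iy₂)/2) + exp(ik φ (y₁-iy₂)/2) - 1` is `y ↦ e^{iky·φ}`. -/
theorem vekua_of_harmonic_exponential (k : ℝ) (hk : 0 < k)
    (φ₁ φ₂ : ℝ) (hφ : φ₁ ^ 2 + φ₂ ^ 2 = 1) :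
    ∀ y : ℝ × ℝ,
      vekua k (fun y =>
          Complex.exp (Complex.I * (k : ℂ) * ((φ₁ : ℂ) - Complex.I * (φ₂ : ℂ)) *
              ((y.1 : ℂ) + Complex.I * (y.2 : ℂ)) / 2) +
          Complex.exp (Complex.I * (k : ℂ) * ((φ₁ : ℂ) + Complex.I * (φ₂ : ℂ)) *
              ((y.1 : ℂ) - Complex.I * (y.2 : ℂ)) / 2) - 1) y
        = Complex.exp (Complex.I * (k : ℂ) * ((y.1 * φ₁ + y.2 * φ₂ : ℝ) : ℂ)) := by
  intro y
  set r := Real.sqrt (y.1 ^ 2 + y.2 ^ 2) with hr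
  set a : ℂ := Complex.I * k * (φ₁ - Complex.I * φ₂) * (y.1 + Complex.I * y.2) / 2 with ha
  set b : ℂ := Complex.I * k * (φ₁ + Complex.I * φ₂) * (y.1 - Complex.I * y.2) / 2 with hb
  have hr2 : (r : ℂ) ^ 2 = (y.1 : ℂ) ^ 2 + (y.2 : ℂ) ^ 2 := by
    exact_mod_cast Real.sq_sqrt (by positivity)
  have hφ' : (φ₁ : ℂ) ^ 2 + (φ₂ : ℂ) ^ 2 = 1 := by exact_mod_cast hφ
  have hI := Complex.I_sq
  have hab : a * b = -((k : ℂ) * r / 2) ^ 2 := by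
    have : a * b = Complex.I ^ 2 * k ^ 2 / 4 * (φ₁ ^ 2 - Complex.I ^ 2 * φ₂ ^ 2) *
        (y.1 ^ 2 - Complex.I ^ 2 * y.2 ^ 2) := by
      rw [ha, hb]; ring
    rw [this, hI, div_pow, mul_pow, hr2]
    linear_combination (-(k : ℂ) ^ 2 / 4 * (y.1 ^ 2 + y.2 ^ 2)) * hφ'
  have hsum : Complex.I * (k : ℂ) * ((y.1 * φ₁ + y.2 * φ₂ : ℝ) : ℂ) = a + b := by
    rw [ha, hb]; push_cast
    linear_combination (Complex.I * k * φ₂ * y.2) * hI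
  rw [hsum, ← exp_add_exp_sub_one_add_integral a b, vekua, ← hr]
  dsimp only
  rw [← ha, ← hb, sub_eq_add_neg (_ + _ - 1)]
  congr 1
  rw [← neg_mul, hab, pow_two, ← neg_mul, mul_assoc (-((k : ℂ) * r / 2)),
    ← intervalIntegral.integral_const_mul ((k : ℂ) * r / 2)]
  rw [show ((k * r / 2 : ℝ) : ℂ) = k * r / 2 by push_cast; rfl]
  congr 1
  refine intervalIntegral.integral_congr_Ioo_of_le (μ := volume) zero_le_one fun t ht => ?_
  have ht' : 0 < 1 - t := by linarith [ht.2]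
  have hs : ((Real.sqrt (1 - t) : ℝ) : ℂ) ≠ 0 := by exact_mod_cast (Real.sqrt_pos.2 ht').ne'
  have hs2 : ((Real.sqrt (1 - t) : ℝ) : ℂ) ^ 2 = 1 - t := by
    exact_mod_cast Real.sq_sqrt ht'.le
  have hat : Complex.I * k * (φ₁ - Complex.I * φ₂) * ((t * y.1 : ℝ) + Complex.I * (t * y.2 : ℝ)) / 2
      = a * t := by
    rw [ha]; push_cast; ring
  have hbt : Complex.I * k * (φ₁ + Complex.I * φ₂) * ((t * y.1 : ℝ) - Complex.I * (t * y.2 : ℝ)) / 2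
      = b * t := by
    rw [hb]; push_cast; ring
  have harg : -(((k * r * Real.sqrt (1 - t) : ℝ) : ℂ) / 2) ^ 2 =
      -((k : ℂ) * r / 2) * (k * r / 2) * (1 - t) := by
    rw [← hs2]; push_cast; ring
  rw [hat, hbt, besselJ_one_eq, harg]
  push_cast
  field_simp
end
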